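/- Let F = ℝ(t) be the field of real rational functions with the derivation d/dt, whose field of constants is ℝ. Let R = F[X,Y]/(X² + Y² − 1), with x, y denoting the images of X, Y, equipped with the unique derivation ∂ extending d/dt on F and satisfying ∂(x) = −y and ∂(y) = x (this is well defined since ∂(X² + Y² − 1) lies in the ideal (X² + Y² − 1)). Then: (a) R is an integral domain; (b) R is differentially simple (every ideal I ⊆ R with ∂(I) ⊆ I is 0 or R); (c) the field of constants of the fraction field of R is ℝ. Consequently R is a Picard-Vessiot ring over ℝ(t) for the matrix A = [[0, −1], [1, 0]], with fundamental solution matrix W = [[x, −y], [y, x]]. -/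

import Mathlib

/-- A derivation on the commutative ring `A` (i.e. an additive map satisfying the Leibniz
rule; every such map is automatically `ℤ`-linear). The `ℤ`-algebra instance is pinned to avoid
typeclass diamonds on concrete rings. -/
abbrev Der (A : Type*) [CommRing A] : Type _ :=
  @Derivation ℤ A A _ _ _ (Ring.toIntAlgebra A) _ _

/-- `R` is a Picard-Vessiot ring over the differential field `F` (with derivation `dF` and
field of constants `K`) for the linear differential equation `∂w = A w`: it is a differential
ring extension of `F`, generated by a fundamental solution matrix `W` together with
`det W⁻¹` (equivalently by the entries of `W` and of `W⁻¹`), it is an integral domain, the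
field of constants of its fraction field is `K` (an element `x/y` of the fraction field is
constant iff `∂x · y = x · ∂y`, and it lies in `K` iff `x = c·y` for some `c ∈ K`), and it is
differentially simple. -/
structure IsPicardVessiotRing (K : Type*) [Field K] (F : Type*) [Field F] [Algebra K F]
    (R : Type*) [CommRing R] [Algebra F R]
    (dF : Derivation ℤ F F) (dR : Derivation ℤ R R)
    {n : ℕ} (A : Matrix (Fin n) (Fin n) F) : Prop where
  extends_deriv : ∀ f : F, dR (algebraMap F R f) = algebraMap F R (dF f)
  isDomain : IsDomain R
  exists_fundamental : ∃ W W' : Matrix (Fin n) (Fin n) R,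
    W * W' = 1 ∧ W' * W = 1 ∧
    (∀ i j, dR (W i j) = (A.map (algebraMap F R) * W) i j) ∧
    Algebra.adjoin F ({x | ∃ i j, W i j = x} ∪ {x | ∃ i j, W' i j = x}) = ⊤
  constants_fraction : ∀ x y : R, y ≠ 0 → dR x * y = x * dR y →
    ∃ c : K, x = algebraMap F R (algebraMap K F c) * y
  simple : ∀ I : Ideal R, (∀ x ∈ I, dR x ∈ I) → I = ⊥ ∨ I = ⊤

open MvPolynomial in
/-- The coordinate ring `ℝ(t)[X,Y]/(X² + Y² - 1)` of the circle over `ℝ(t)`. -/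
noncomputable abbrev CircleRing : Type _ :=
  MvPolynomial (Fin 2) (RatFunc ℝ) ⧸
    Ideal.span {(X 0 ^ 2 + X 1 ^ 2 - 1 : MvPolynomial (Fin 2) (RatFunc ℝ))}

open MvPolynomial in
/-- The image `x` (i.e. "cos t") of `X` in `CircleRing`. -/
noncomputable def cx : CircleRing := Ideal.Quotient.mk _ (X 0)

open MvPolynomial in
/-- The image `y` (i.e. "sin t") of `Y` in `CircleRing`. -/
noncomputable def cy : CircleRing := Ideal.Quotient.mk _ (X 1)

open Polynomial in
/-- The derivation on `L[X]` extending `D` on `L` and sending `X` to `a * X`. -/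
noncomputable def expDeriv {L : Type*} [CommRing L] (D : L →+ L) (a : L) (p : L[X]) : L[X] :=
  ∑ n ∈ Finset.range (p.natDegree + 1), monomial n (D (p.coeff n) + n * a * p.coeff n)

section Exponential

open Polynomial

theorem coeff_expDeriv {L : Type*} [CommRing L] (D : L →+ L) (a : L) (p : L[X]) (n : ℕ) :
    (expDeriv D a p).coeff n = D (p.coeff n) + n * a * p.coeff n := by
  simp only [expDeriv, finsetSum_coeff, coeff_monomial, Finset.sum_ite_eq', Finset.mem_range]
  split_ifs with h
  · rfl
  · rw [coeff_eq_zero_of_natDegree_lt (by omega)]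
    simp

theorem map_one_eq_zero_of_leibniz {S : Type*} [CommRing S] (D : S →+ S)
    (hD : ∀ x y, D (x * y) = x * D y + D x * y) : D 1 = 0 := by
  have h := hD 1 1
  simpa using h

theorem map_pow_of_exponential {S : Type*} [CommRing S] (D : S →+ S)
    (hD : ∀ x y, D (x * y) = x * D y + D x * y) {T a : S} (hT : D T = a * T) (n : ℕ) :
    D (T ^ n) = n * a * T ^ n := by
  induction n with
  | zero => simp [map_one_eq_zero_of_leibniz D hD]
  | succ n ih =>
    rw [pow_succ, hD, ih, hT]
    push_cast
    ring

theorem map_eval₂_eq_eval₂_expDeriv {L S : Type*} [CommRing L] [CommRing S] (D : L →+ L)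
    (E : S →+ S) (hE : ∀ x y, E (x * y) = x * E y + E x * y) (φ : L →+* S)
    (hφ : ∀ c, E (φ c) = φ (D c)) {T : S} {a : L} (hT : E T = φ a * T) (p : L[X]) :
    E (p.eval₂ φ T) = (expDeriv D a p).eval₂ φ T := by
  rw [expDeriv, eval₂_finsetSum, eval₂_eq_sum_range, map_sum]
  refine Finset.sum_congr rfl fun n _ => ?_
  rw [hE, map_pow_of_exponential E hE hT, hφ, eval₂_monomial]
  simp only [map_add, map_mul, map_natCast]
  ring

variable {L S : Type*} [Field L] [CommRing S] {D : L →+ L} {E : S →+ S} {φ : L →+* S} {T : S}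
  {a : L}

/-- A differential ideal containing a nonzero polynomial in an exponential `T` whose integer
powers have no solution of the associated equations in `L` is the whole ring. -/
theorem eq_top_of_eval₂_mem
    (hD1 : D 1 = 0) (hE : ∀ x y, E (x * y) = x * E y + E x * y)
    (hφ : ∀ c, E (φ c) = φ (D c)) (hT : E T = φ a * T) (hTu : IsUnit T)
    (hexp : ∀ (c : L) (n : ℤ), n ≠ 0 → D c = n * a * c → c = 0)
    (I : Ideal S) (hI : ∀ s ∈ I, E s ∈ I) (p : L[X]) (hp : p ≠ 0) (hpI : p.eval₂ φ T ∈ I) :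
    I = ⊤ := by
  induction hn : p.natDegree using Nat.strong_induction_on generalizing p with
  | _ n ih =>
  wlog hm : p.Monic generalizing p
  · refine this (p * C p.leadingCoeff⁻¹) ?_ ?_ ?_ (monic_mul_leadingCoeff_inv hp)
    · simpa using hp
    · rw [eval₂_mul]
      exact I.mul_mem_right _ hpI
    · rw [natDegree_mul_leadingCoeff_inv p hp, hn]
  set r : L[X] := expDeriv D a p - C (n * a) * p with hr
  have hcoeff (j : ℕ) : r.coeff j = D (p.coeff j) + (j - n : ℤ) * a * p.coeff j := by
    rw [hr, coeff_sub, coeff_C_mul, coeff_expDeriv]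
    push_cast
    ring
  have hrI : r.eval₂ φ T ∈ I := by
    rw [hr, eval₂_sub, eval₂_mul, ← map_eval₂_eq_eval₂_expDeriv D E hE φ hφ hT]
    exact I.sub_mem (hI _ hpI) (I.mul_mem_left _ hpI)
  by_cases hr0 : r = 0
  · by_cases hn0 : n = 0
    · have : p = 1 := hm.natDegree_eq_zero.mp (hn.trans hn0)
      rw [this, eval₂_one] at hpI
      exact (Ideal.eq_top_iff_one I).2 hpI
    · have h0 : p.coeff 0 = 0 := by
        refine hexp _ n (by exact_mod_cast hn0) ?_
        have h := hcoeff 0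
        rw [hr0, coeff_zero] at h
        push_cast at h ⊢
        linear_combination -h
      have hpX : p.divX * X = p := by
        simpa [h0] using p.divX_mul_X_add
      refine ih (p.divX.natDegree) ?_ p.divX ?_ ?_ rfl
      · rw [natDegree_divX_eq_natDegree_tsub_one]
        omega
      · rintro h
        rw [h, zero_mul] at hpX
        exact hp hpX.symm
      · rw [← hpX, eval₂_mul_X] at hpI
        exact (Ideal.mul_unit_mem_iff_mem I hTu).1 hpI
  · refine ih r.natDegree ?_ r hr0 hrI rfl
    have hle : r.natDegree ≤ n := by
      refine natDegree_le_iff_coeff_eq_zero.2 fun j hj => ?_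
      rw [hcoeff, coeff_eq_zero_of_natDegree_lt (by omega)]
      simp
    refine lt_of_le_of_ne hle fun h => hr0 ?_
    have hlc : r.leadingCoeff = 0 := by
      have h1 : p.coeff n = 1 := hn ▸ hm.coeff_natDegree
      rw [leadingCoeff, h, hcoeff, h1, hD1]
      simp
    exact leadingCoeff_eq_zero.1 hlc

variable (hD1 : D 1 = 0) (hE : ∀ x y, E (x * y) = x * E y + E x * y)
  (hφ : ∀ c, E (φ c) = φ (D c)) (hT : E T = φ a * T) (hTu : IsUnit T)
  (hexp : ∀ (c : L) (n : ℤ), n ≠ 0 → D c = n * a * c → c = 0)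
  (hgen : ∀ s : S, ∃ (k : ℕ) (p : L[X]), T ^ k * s = p.eval₂ φ T)

include hD1 hE hφ hT hTu hexp

theorem eval₂_exponential_eq_zero_iff [Nontrivial S] (p : L[X]) :
    p.eval₂ φ T = 0 ↔ p = 0 := by
  refine ⟨fun h => ?_, fun h => by simp [h]⟩
  by_contra hp
  refine bot_ne_top (eq_top_of_eval₂_mem hD1 hE hφ hT hTu hexp ⊥ ?_ p hp (by simpa using h))
  simp

include hgen

theorem differentiallySimple_of_exponential (I : Ideal S) (hI : ∀ s ∈ I, E s ∈ I) :
    I = ⊥ ∨ I = ⊤ := by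
  by_cases h : ∃ p : L[X], p ≠ 0 ∧ p.eval₂ φ T ∈ I
  · obtain ⟨p, hp, hpI⟩ := h
    exact .inr (eq_top_of_eval₂_mem hD1 hE hφ hT hTu hexp I hI p hp hpI)
  · push Not at h
    refine .inl ((Submodule.eq_bot_iff I).2 fun s hs => ?_)
    obtain ⟨k, p, hkp⟩ := hgen s
    have hp : p = 0 := by
      by_contra hp
      exact h p hp (hkp ▸ I.mul_mem_left _ hs)
    rw [hp, eval₂_zero] at hkp
    exact (hTu.pow k).mul_right_eq_zero.1 hkp

theorem isDomain_of_exponential [Nontrivial S] : IsDomain S := by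
  have hz := eval₂_exponential_eq_zero_iff hD1 hE hφ hT hTu hexp
  have : NoZeroDivisors S := by
    refine ⟨fun {s t} hst => ?_⟩
    obtain ⟨k, p, hp⟩ := hgen s
    obtain ⟨l, q, hq⟩ := hgen t
    have hpq : (p * q).eval₂ φ T = 0 := by
      rw [eval₂_mul, ← hp, ← hq]
      linear_combination T ^ k * T ^ l * hst
    rcases mul_eq_zero.1 ((hz _).1 hpq) with h | h
    · rw [h, eval₂_zero] at hp
      exact .inl ((hTu.pow k).mul_right_eq_zero.1 hp)
    · rw [h, eval₂_zero] at hq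
      exact .inr ((hTu.pow l).mul_right_eq_zero.1 hq)
  exact NoZeroDivisors.to_isDomain S

theorem exists_eq_of_constant [Nontrivial S] (s : S) (hs : E s = 0) :
    ∃ c : L, s = φ c := by
  obtain ⟨k, p, hp⟩ := hgen s
  have h0 : (expDeriv D a p - C (k * a) * p).eval₂ φ T = 0 := by
    rw [eval₂_sub, eval₂_mul, ← map_eval₂_eq_eval₂_expDeriv D E hE φ hφ hT, ← hp, hE, hs,
      map_pow_of_exponential E hE hT, eval₂_C, map_mul, map_natCast]
    ring
  rw [eval₂_exponential_eq_zero_iff hD1 hE hφ hT hTu hexp] at h0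
  have hpm : p = monomial k (p.coeff k) := by
    ext j
    rw [coeff_monomial]
    split_ifs with hj
    · rw [hj]
    · refine hexp _ (k - j) (by omega) ?_
      have h := congrArg (fun q => q.coeff j) h0
      simp only [coeff_sub, coeff_C_mul, coeff_expDeriv, coeff_zero] at h
      push_cast
      linear_combination h
  refine ⟨p.coeff k, (hTu.pow k).mul_left_cancel ?_⟩
  rw [hp, hpm, eval₂_monomial, coeff_monomial, if_pos rfl, mul_comm]

end Exponential

section Complexification

open QuadraticAlgebra

/-- The componentwise extension of an additive map to `A[i]`. -/
def complexifyAddHom {A : Type*} [CommRing A] (d : A →+ A) :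
    QuadraticAlgebra A (-1) 0 →+ QuadraticAlgebra A (-1) 0 where
  toFun z := ⟨d z.re, d z.im⟩
  map_zero' := by ext <;> simp
  map_add' z w := by ext <;> simp

/-- The ring homomorphism `F[i] → R[i]` induced by an algebra structure. -/
def complexifyAlgebraMap (F R : Type*) [CommRing F] [CommRing R] [Algebra F R] :
    QuadraticAlgebra F (-1) 0 →+* QuadraticAlgebra R (-1) 0 where
  toFun z := ⟨algebraMap F R z.re, algebraMap F R z.im⟩
  map_zero' := by ext <;> simp
  map_one' := by ext <;> simp
  map_add' z w := by ext <;> simp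
  map_mul' z w := by ext <;> simp

theorem complexifyAddHom_leibniz {A : Type*} [CommRing A] (d : A →+ A)
    (hd : ∀ x y, d (x * y) = x * d y + d x * y) (z w : QuadraticAlgebra A (-1) 0) :
    complexifyAddHom d (z * w) = z * complexifyAddHom d w + complexifyAddHom d z * w := by
  ext <;> simp [complexifyAddHom, hd] <;> ring

variable {F R : Type*} [Field F] [CommRing R] [Algebra F R]

open Polynomial in
/-- `R[i]` is generated over `F[i]` by `T = x + i y` and its inverse. -/
theorem exists_pow_mul_eq_eval₂ (h2 : (2 : F) ≠ 0) {x y : R} (hxy : x ^ 2 + y ^ 2 = 1)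
    (hadj : Algebra.adjoin F {x, y} = ⊤) (s : QuadraticAlgebra R (-1) 0) :
    ∃ (k : ℕ) (p : (QuadraticAlgebra F (-1) 0)[X]),
      (⟨x, y⟩ : QuadraticAlgebra R (-1) 0) ^ k * s =
        p.eval₂ (complexifyAlgebraMap F R) ⟨x, y⟩ := by
  set T : QuadraticAlgebra R (-1) 0 := ⟨x, y⟩ with hTdef
  set φ := complexifyAlgebraMap F R with hφdef
  have hadd (s t : QuadraticAlgebra R (-1) 0)
      (hs : ∃ (k : ℕ) (p : (QuadraticAlgebra F (-1) 0)[X]), T ^ k * s = p.eval₂ φ T)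
      (ht : ∃ (k : ℕ) (p : (QuadraticAlgebra F (-1) 0)[X]), T ^ k * t = p.eval₂ φ T) :
      ∃ (k : ℕ) (p : (QuadraticAlgebra F (-1) 0)[X]), T ^ k * (s + t) = p.eval₂ φ T := by
    obtain ⟨k, p, hp⟩ := hs
    obtain ⟨l, q, hq⟩ := ht
    refine ⟨k + l, X ^ l * p + X ^ k * q, ?_⟩
    simp only [eval₂_add, eval₂_mul, eval₂_X_pow, ← hp, ← hq]
    ring
  have hmul (s t : QuadraticAlgebra R (-1) 0)
      (hs : ∃ (k : ℕ) (p : (QuadraticAlgebra F (-1) 0)[X]), T ^ k * s = p.eval₂ φ T)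
      (ht : ∃ (k : ℕ) (p : (QuadraticAlgebra F (-1) 0)[X]), T ^ k * t = p.eval₂ φ T) :
      ∃ (k : ℕ) (p : (QuadraticAlgebra F (-1) 0)[X]), T ^ k * (s * t) = p.eval₂ φ T := by
    obtain ⟨k, p, hp⟩ := hs
    obtain ⟨l, q, hq⟩ := ht
    refine ⟨k + l, p * q, ?_⟩
    simp only [eval₂_mul, ← hp, ← hq]
    ring
  have hhalf : algebraMap F R 2⁻¹ * 2 = 1 := by
    rw [← map_ofNat (algebraMap F R) 2, ← map_mul, inv_mul_cancel₀ h2, map_one]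
  have hreal (r : R) : ∃ (k : ℕ) (p : (QuadraticAlgebra F (-1) 0)[X]),
      T ^ k * algebraMap R _ r = p.eval₂ φ T := by
    have hr : r ∈ Algebra.adjoin F {x, y} := hadj ▸ Algebra.mem_top
    induction hr using Algebra.adjoin_induction with
    | mem r hr =>
      rcases hr with rfl | rfl
      · refine ⟨1, C ⟨2⁻¹, 0⟩ * (X ^ 2 + 1), ?_⟩
        simp only [eval₂_mul, eval₂_C, eval₂_add, eval₂_X_pow, eval₂_one, pow_one]
        ext
        · simp [hTdef, hφdef, complexifyAlgebraMap, pow_two]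
          linear_combination (-r ^ 2) * hhalf + algebraMap F R 2⁻¹ * hxy
        · simp [hTdef, hφdef, complexifyAlgebraMap, pow_two]
          linear_combination (-r * y) * hhalf
      · refine ⟨1, C ⟨0, -2⁻¹⟩ * (X ^ 2 - 1), ?_⟩
        simp only [eval₂_mul, eval₂_C, eval₂_sub, eval₂_X_pow, eval₂_one, pow_one]
        ext
        · simp [hTdef, hφdef, complexifyAlgebraMap, pow_two]
          linear_combination (-x * r) * hhalf
        · simp [hTdef, hφdef, complexifyAlgebraMap, pow_two]
          linear_combination (-r ^ 2) * hhalf + algebraMap F R 2⁻¹ * hxy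
    | algebraMap c =>
      refine ⟨0, C ⟨c, 0⟩, ?_⟩
      rw [eval₂_C]
      ext <;> simp [hφdef, complexifyAlgebraMap]
    | add r t _ _ hr ht =>
      rw [map_add]
      exact hadd _ _ hr ht
    | mul r t _ _ hr ht =>
      rw [map_mul]
      exact hmul _ _ hr ht
  have hs : s = algebraMap R _ s.re + ω * algebraMap R _ s.im := by
    ext <;> simp
  rw [hs]
  refine hadd _ _ (hreal _) (hmul _ _ ⟨0, C ω, ?_⟩ (hreal _))
  rw [eval₂_C]
  ext <;> simp [hφdef, complexifyAlgebraMap]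

/-- Structure of a differential ring generated by a circle `x ^ 2 + y ^ 2 = 1` rotating at unit
speed, over a differential field in which no nontrivial rotation equation is solvable. -/
theorem circle_differential_structure [Nontrivial R] (h2 : (2 : F) ≠ 0)
    (hsq : ∀ r : F, r ^ 2 ≠ -1) (dF : F →+ F) (hdF : ∀ x y, dF (x * y) = x * dF y + dF x * y)
    (hrot : ∀ (u v : F) (n : ℤ), n ≠ 0 → dF u = -(n * v) → dF v = n * u → u = 0 ∧ v = 0)
    (dR : R →+ R) (hdR : ∀ x y, dR (x * y) = x * dR y + dR x * y)
    (hext : ∀ f, dR (algebraMap F R f) = algebraMap F R (dF f)) {x y : R}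
    (hxy : x ^ 2 + y ^ 2 = 1) (hadj : Algebra.adjoin F {x, y} = ⊤) (hx : dR x = -y)
    (hy : dR y = x) :
    IsDomain R ∧ (∀ I : Ideal R, (∀ z ∈ I, dR z ∈ I) → I = ⊥ ∨ I = ⊤) ∧
      ∀ z : R, dR z = 0 → ∃ f : F, z = algebraMap F R f := by
  have : Fact (∀ r : F, r ^ 2 ≠ -1 + 0 * r) := ⟨by simpa using hsq⟩
  have hD1 : complexifyAddHom dF 1 = 0 :=
    map_one_eq_zero_of_leibniz _ (complexifyAddHom_leibniz dF hdF)
  have hE := complexifyAddHom_leibniz dR hdR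
  have hφ (c) : complexifyAddHom dR (complexifyAlgebraMap F R c) =
      complexifyAlgebraMap F R (complexifyAddHom dF c) := by
    ext <;> simp [complexifyAddHom, complexifyAlgebraMap, hext]
  have hT : complexifyAddHom dR ⟨x, y⟩ = complexifyAlgebraMap F R ω * ⟨x, y⟩ := by
    ext <;> simp [complexifyAddHom, complexifyAlgebraMap, hx, hy]
  have hTu : IsUnit (⟨x, y⟩ : QuadraticAlgebra R (-1) 0) := by
    refine IsUnit.of_mul_eq_one ⟨x, -y⟩ ?_
    ext
    · simp
      linear_combination hxy
    · simp
      ring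
  have hexp (c : QuadraticAlgebra F (-1) 0) (n : ℤ) (hn : n ≠ 0)
      (hc : complexifyAddHom dF c = n * (ω : QuadraticAlgebra F (-1) 0) * c) : c = 0 := by
    have hre := congrArg QuadraticAlgebra.re hc
    have him := congrArg QuadraticAlgebra.im hc
    simp [complexifyAddHom] at hre him
    obtain ⟨h, h'⟩ := hrot c.re c.im n hn hre him
    ext <;> simp [h, h']
  have hgen := exists_pow_mul_eq_eval₂ h2 hxy hadj
  refine ⟨?_, fun I hI => ?_, fun z hz => ?_⟩
  · have := isDomain_of_exponential hD1 hE hφ hT hTu hexp hgen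
    exact (algebraMap_injective (R := R) (a := -1) (b := 0)).isDomain (algebraMap R _)
  · let J : Ideal (QuadraticAlgebra R (-1) 0) :=
      { carrier := {s | s.re ∈ I ∧ s.im ∈ I}
        zero_mem' := by simp
        add_mem' := fun hs ht => ⟨I.add_mem hs.1 ht.1, I.add_mem hs.2 ht.2⟩
        smul_mem' := fun c s hs => by
          refine ⟨?_, ?_⟩
          · simpa using I.add_mem (I.mul_mem_left c.re hs.1) (I.neg_mem (I.mul_mem_left c.im hs.2))
          · simpa using I.add_mem (I.mul_mem_left c.re hs.2) (I.mul_mem_left c.im hs.1) }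
    have hJ := differentiallySimple_of_exponential hD1 hE hφ hT hTu hexp hgen J
      fun s hs => ⟨hI _ hs.1, hI _ hs.2⟩
    refine hJ.imp (fun h => (Submodule.eq_bot_iff I).2 fun r hr => ?_) fun h => ?_
    · have hrJ : algebraMap R (QuadraticAlgebra R (-1) 0) r ∈ J := ⟨hr, I.zero_mem⟩
      rw [h] at hrJ
      exact congrArg QuadraticAlgebra.re ((Submodule.mem_bot _).1 hrJ)
    · have h1 : (1 : QuadraticAlgebra R (-1) 0) ∈ J := h ▸ Submodule.mem_top
      exact (Ideal.eq_top_iff_one I).2 h1.1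
  · obtain ⟨c, hc⟩ := exists_eq_of_constant hD1 hE hφ hT hTu hexp hgen
      (algebraMap R _ z) (by ext <;> simp [complexifyAddHom, hz])
    exact ⟨c.re, congrArg QuadraticAlgebra.re hc⟩

end Complexification

/-- In a differentially simple domain, a constant of the fraction field is a constant of the
ring. -/
theorem exists_constant_mul_eq {R : Type*} [CommRing R] [IsDomain R] (d : R →+ R)
    (hd : ∀ x y, d (x * y) = x * d y + d x * y)
    (hsimple : ∀ I : Ideal R, (∀ z ∈ I, d z ∈ I) → I = ⊥ ∨ I = ⊤) {a b : R} (hb : b ≠ 0)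
    (hab : d a * b = a * d b) : ∃ s, d s = 0 ∧ a = s * b := by
  let I : Ideal R := Submodule.comap (LinearMap.toSpanSingleton R R a) (Ideal.span {b})
  have hI : ∀ r, r ∈ I ↔ ∃ s, s * b = r * a := fun r => Ideal.mem_span_singleton'
  have htop : I = ⊤ := by
    refine (hsimple I fun r hr => ?_).resolve_left fun h => hb ?_
    · obtain ⟨s, hs⟩ := (hI r).1 hr
      refine (hI _).2 ⟨d s, mul_right_cancel₀ hb ?_⟩
      have h := congrArg d hs
      rw [hd, hd] at h
      linear_combination b * h - d b * hs + r * hab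
    · have hbI : b ∈ I := (hI b).2 ⟨a, mul_comm a b⟩
      rwa [h] at hbI
  obtain ⟨s, hs⟩ := (hI 1).1 (htop ▸ Submodule.mem_top)
  rw [one_mul] at hs
  refine ⟨s, mul_right_cancel₀ (mul_ne_zero hb hb) ?_, hs.symm⟩
  have h := congrArg d hs
  rw [hd] at h
  linear_combination b * h - d b * hs + hab

section RationalFunctions

open Polynomial

/-- Leibniz rule for `Der`, usable on rings with several `ℤ`-algebra instances. -/
theorem Der.map_mul {A : Type*} [CommRing A] (d : Der A) (x y : A) :
    d (x * y) = x * d y + d x * y := by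
  rw [d.leibniz, smul_eq_mul, smul_eq_mul, mul_comm y]

theorem RatFunc.sq_ne_neg_one (r : RatFunc ℝ) : r ^ 2 ≠ -1 := by
  intro h
  have hq : algebraMap ℝ[X] (RatFunc ℝ) r.denom ≠ 0 :=
    RatFunc.algebraMap_ne_zero r.denom_ne_zero
  have hr : r * algebraMap ℝ[X] (RatFunc ℝ) r.denom = algebraMap ℝ[X] (RatFunc ℝ) r.num := by
    rw [← eq_div_iff hq, RatFunc.num_div_denom]
  have hpq : r.num ^ 2 + r.denom ^ 2 = 0 := by
    apply RatFunc.algebraMap_injective ℝ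
    rw [map_add, map_pow, map_pow, ← hr, map_zero]
    linear_combination (algebraMap ℝ[X] (RatFunc ℝ) r.denom) ^ 2 * h
  refine r.denom_ne_zero (Polynomial.funext fun t => ?_)
  have ht := congrArg (Polynomial.eval t) hpq
  simp only [Polynomial.eval_add, Polynomial.eval_pow, Polynomial.eval_zero] at ht ⊢
  nlinarith [sq_nonneg (r.num.eval t), sq_nonneg (r.denom.eval t)]

variable {K : Type*} [Field K] (d : RatFunc K →+ RatFunc K)
  (hd : ∀ x y, d (x * y) = x * d y + d x * y) (hX : d RatFunc.X = 1)
  (hC : ∀ c : K, d (RatFunc.C c) = 0)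

include hd hX hC

theorem RatFunc.deriv_algebraMap (p : K[X]) :
    d (algebraMap K[X] (RatFunc K) p) = algebraMap K[X] (RatFunc K) (derivative p) := by
  induction p using Polynomial.induction_on' with
  | add p q hp hq => simp [hp, hq]
  | monomial n c =>
    have hpow (m : ℕ) : d ((RatFunc.X : RatFunc K) ^ m) = m * (RatFunc.X : RatFunc K) ^ (m - 1) := by
      induction m with
      | zero => simpa using map_one_eq_zero_of_leibniz d hd
      | succ m ih =>
        rw [pow_succ, hd, ih, hX]
        rcases m with _ | m
        · simp
        · simp only [Nat.add_sub_cancel]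
          push_cast
          ring
    rw [derivative_monomial, ← C_mul_X_pow_eq_monomial, ← C_mul_X_pow_eq_monomial]
    simp only [map_mul, map_pow, RatFunc.algebraMap_C, RatFunc.algebraMap_X, hd, hC, hpow,
      map_natCast]
    ring

/-- Differentiation strictly lowers the degree of a rational function. -/
theorem RatFunc.intDegree_deriv_lt (f : RatFunc K) (hf : d f ≠ 0) :
    (d f).intDegree < f.intDegree := by
  set p := f.num
  set q := f.denom
  have hq0 : q ≠ 0 := f.denom_ne_zero
  have hq : algebraMap K[X] (RatFunc K) q ≠ 0 := RatFunc.algebraMap_ne_zero hq0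
  have hfq : f * algebraMap K[X] (RatFunc K) q = algebraMap K[X] (RatFunc K) p := by
    rw [← eq_div_iff hq, RatFunc.num_div_denom]
  have hder := congrArg d hfq
  rw [hd, RatFunc.deriv_algebraMap d hd hX hC, RatFunc.deriv_algebraMap d hd hX hC] at hder
  have hmain : d f * algebraMap K[X] (RatFunc K) (q * q) =
      algebraMap K[X] (RatFunc K) (derivative p * q - p * derivative q) := by
    simp only [map_mul, map_sub]
    linear_combination algebraMap K[X] (RatFunc K) q * hder -
      algebraMap K[X] (RatFunc K) (derivative q) * hfq
  have hw : derivative p * q - p * derivative q ≠ 0 := by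
    intro h
    rw [h, map_zero, map_mul] at hmain
    exact hf ((mul_eq_zero.1 hmain).resolve_right (mul_ne_zero hq hq))
  have hdeg := congrArg RatFunc.intDegree hmain
  rw [RatFunc.intDegree_mul hf (RatFunc.algebraMap_ne_zero (mul_ne_zero hq0 hq0)),
    RatFunc.intDegree_polynomial, RatFunc.intDegree_polynomial, natDegree_mul hq0 hq0] at hdeg
  have hlt : (derivative p * q - p * derivative q).natDegree < p.natDegree + q.natDegree := by
    have hp0 : p ≠ 0 := by
      rintro h
      simp [h] at hw
    refine natDegree_lt_natDegree hw ?_ |>.trans_eq (natDegree_mul hp0 hq0)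
    refine (degree_sub_le _ _).trans_lt (max_lt ?_ ?_)
    · rw [degree_mul, degree_mul]
      exact WithBot.add_lt_add_right (degree_ne_bot.2 hq0) (degree_derivative_lt hp0)
    · rw [degree_mul, degree_mul]
      exact WithBot.add_lt_add_left (degree_ne_bot.2 hp0) (degree_derivative_lt hq0)
  have hfdeg : f.intDegree = p.natDegree - q.natDegree := rfl
  push_cast at hdeg
  omega

/-- The only rational solution of a rotation equation with nonzero integer speed is zero. -/
theorem RatFunc.eq_zero_of_rotation [CharZero K] (u v : RatFunc K) (n : ℤ) (hn : n ≠ 0)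
    (hu : d u = -(n * v)) (hv : d v = n * u) : u = 0 ∧ v = 0 := by
  have hC0 : RatFunc.C (n : K) ≠ 0 := by
    simpa using hn
  have hn' : (n : RatFunc K) = RatFunc.C (n : K) := by simp
  have hnK : (n : RatFunc K) ≠ 0 := hn' ▸ hC0
  have hun : u = 0 → v = 0 := by
    rintro rfl
    rw [map_zero, zero_eq_neg] at hu
    exact (mul_eq_zero.1 hu).resolve_left hnK
  by_contra hcon
  have hu0 : u ≠ 0 := fun h => hcon ⟨h, hun h⟩
  have hv0 : v ≠ 0 := by
    rintro rfl
    rw [map_zero] at hv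
    exact hu0 ((mul_eq_zero.1 hv.symm).resolve_left hnK)
  have h1 := RatFunc.intDegree_deriv_lt d hd hX hC u
    (by rw [hu]; exact neg_ne_zero.2 (mul_ne_zero hnK hv0))
  have h2 := RatFunc.intDegree_deriv_lt d hd hX hC v (by rw [hv]; exact mul_ne_zero hnK hu0)
  rw [hu, RatFunc.intDegree_neg, RatFunc.intDegree_mul hnK hv0, hn', RatFunc.intDegree_C] at h1
  rw [hv, RatFunc.intDegree_mul hnK hu0, hn', RatFunc.intDegree_C] at h2
  omega

end RationalFunctions

section CircleRing

open MvPolynomial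

theorem cx_sq_add_cy_sq : cx ^ 2 + cy ^ 2 = 1 := by
  have h : (Ideal.Quotient.mk (Ideal.span
      {(X 0 ^ 2 + X 1 ^ 2 - 1 : MvPolynomial (Fin 2) (RatFunc ℝ))}))
      (X 0 ^ 2 + X 1 ^ 2 - 1) = 0 :=
    Ideal.Quotient.eq_zero_iff_mem.2 (Ideal.mem_span_singleton_self _)
  rw [map_sub, map_add, map_pow, map_pow, map_one] at h
  exact sub_eq_zero.1 h

theorem adjoin_cx_cy : Algebra.adjoin (RatFunc ℝ) {cx, cy} = ⊤ := by
  let π := Ideal.Quotient.mkₐ (RatFunc ℝ) (Ideal.span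
      {(X 0 ^ 2 + X 1 ^ 2 - 1 : MvPolynomial (Fin 2) (RatFunc ℝ))})
  have h := congrArg (Subalgebra.map π) (adjoin_range_X (σ := Fin 2) (R := RatFunc ℝ))
  rw [AlgHom.map_adjoin, Algebra.map_top,
    (AlgHom.range_eq_top π).2 (Ideal.Quotient.mkₐ_surjective _ _)] at h
  rw [← h]
  congr 1
  ext z
  simp only [Set.mem_insert_iff, Set.mem_singleton_iff, Set.mem_image, Set.mem_range,
    Fin.exists_fin_two]
  constructor
  · rintro (rfl | rfl)
    · exact ⟨_, .inl rfl, rfl⟩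
    · exact ⟨_, .inr rfl, rfl⟩
  · rintro ⟨_, rfl | rfl, rfl⟩
    · exact .inl rfl
    · exact .inr rfl

theorem nontrivial_circleRing : Nontrivial CircleRing := by
  refine Ideal.Quotient.nontrivial_iff.2 fun h => ?_
  have hle : Ideal.span {(X 0 ^ 2 + X 1 ^ 2 - 1 : MvPolynomial (Fin 2) (RatFunc ℝ))} ≤
      RingHom.ker (MvPolynomial.eval (![1, 0] : Fin 2 → RatFunc ℝ)) := by
    rw [Ideal.span_singleton_le_iff_mem, RingHom.mem_ker]
    simp
  rw [h, top_le_iff] at hle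
  exact RingHom.ker_ne_top _ hle

end CircleRing

/-- Let `F = ℝ(t)` with the derivation `d/dt` (so `∂t = 1`, `∂` vanishes on
`ℝ`, and the field of constants is `ℝ`), and let `R = F[X,Y]/(X² + Y² − 1)` carry the unique
derivation extending `d/dt` with `∂x = −y`, `∂y = x`. Then (a) `R` is an integral domain,
(b) `R` is differentially simple, (c) the field of constants of the fraction field of `R` is
`ℝ`; consequently `R` is a Picard-Vessiot ring over `ℝ(t)` for the matrix
`A = [[0, −1], [1, 0]]`, with fundamental solution matrix `W = [[x, −y], [y, x]]`. -/
theorem circleRing_isPicardVessiot (dF : Der (RatFunc ℝ))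
    (hX : dF RatFunc.X = 1) (hC : ∀ c : ℝ, dF (RatFunc.C c) = 0)
    (hK : ∀ f : RatFunc ℝ, dF f = 0 ↔ ∃ c : ℝ, f = RatFunc.C c)
    (dR : Der CircleRing)
    (hext : ∀ f : RatFunc ℝ,
      dR (algebraMap (RatFunc ℝ) CircleRing f) = algebraMap (RatFunc ℝ) CircleRing (dF f))
    (hx : dR cx = -cy) (hy : dR cy = cx) :
    -- (a) `R` is an integral domain:
    IsDomain CircleRing ∧
    -- (b) `R` is differentially simple:
    (∀ I : Ideal CircleRing, (∀ z ∈ I, dR z ∈ I) → I = ⊥ ∨ I = ⊤) ∧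
    -- (c) the field of constants of the fraction field of `R` is `ℝ`:
    (∀ a b : CircleRing, b ≠ 0 → dR a * b = a * dR b →
      ∃ r : ℝ, a = algebraMap (RatFunc ℝ) CircleRing (RatFunc.C r) * b) ∧
    -- `W = [[x, −y], [y, x]]` is a fundamental solution matrix for `A = [[0,−1],[1,0]]`:
    (!![cx, -cy; cy, cx] * !![cx, cy; -cy, cx] = 1 ∧
     !![cx, cy; -cy, cx] * !![cx, -cy; cy, cx] = 1 ∧
     (∀ i j, dR (!![cx, -cy; cy, cx] i j) =
        ((!![0, -1; 1, 0] : Matrix (Fin 2) (Fin 2) (RatFunc ℝ)).map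
          (algebraMap (RatFunc ℝ) CircleRing) * !![cx, -cy; cy, cx]) i j) ∧
     Algebra.adjoin (RatFunc ℝ)
       ({z | ∃ i j, !![cx, -cy; cy, cx] i j = z} ∪
        {z | ∃ i j, !![cx, cy; -cy, cx] i j = z}) = ⊤) ∧
    -- consequently `R` is a Picard-Vessiot ring over `ℝ(t)` for `A`:
    IsPicardVessiotRing ℝ (RatFunc ℝ) CircleRing dF dR
      (!![0, -1; 1, 0] : Matrix (Fin 2) (Fin 2) (RatFunc ℝ)) := by
  have hNontriv := nontrivial_circleRing
  have hxy := cx_sq_add_cy_sq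
  let dF' : RatFunc ℝ →+ RatFunc ℝ := AddMonoidHom.mk' dF fun a b => map_add dF a b
  let dR' : CircleRing →+ CircleRing := AddMonoidHom.mk' dR fun a b => map_add dR a b
  have hdF : ∀ a b, dF' (a * b) = a * dF' b + dF' a * b := Der.map_mul dF
  have hdR : ∀ a b, dR' (a * b) = a * dR' b + dR' a * b := Der.map_mul dR
  obtain ⟨hdom, hsimple, hconst⟩ := circle_differential_structure two_ne_zero
    RatFunc.sq_ne_neg_one dF' hdF (RatFunc.eq_zero_of_rotation dF' hdF hX hC) dR' hdR hext hxy
    adjoin_cx_cy hx hy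
  have hfrac : ∀ a b : CircleRing, b ≠ 0 → dR a * b = a * dR b →
      ∃ r : ℝ, a = algebraMap (RatFunc ℝ) CircleRing (RatFunc.C r) * b := by
    intro a b hb hab
    obtain ⟨s, hs, hsb⟩ := exists_constant_mul_eq dR' hdR hsimple hb hab
    obtain ⟨f, hf⟩ := hconst s hs
    have hdf : dF f = 0 := by
      apply (algebraMap (RatFunc ℝ) CircleRing).injective
      rw [← hext, ← hf, map_zero]
      exact hs
    obtain ⟨r, hr⟩ := (hK f).1 hdf
    exact ⟨r, by rw [hsb, hf, hr]⟩
  have hW : !![cx, -cy; cy, cx] * !![cx, cy; -cy, cx] = 1 := by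
    ext i j
    fin_cases i <;> fin_cases j <;> simp [Matrix.mul_apply, Fin.sum_univ_two] <;>
      first | ring1 | linear_combination hxy
  have hW' : !![cx, cy; -cy, cx] * !![cx, -cy; cy, cx] = 1 := by
    ext i j
    fin_cases i <;> fin_cases j <;> simp [Matrix.mul_apply, Fin.sum_univ_two] <;>
      first | ring1 | linear_combination hxy
  have hsol : ∀ i j, dR (!![cx, -cy; cy, cx] i j) =
      ((!![0, -1; 1, 0] : Matrix (Fin 2) (Fin 2) (RatFunc ℝ)).map
        (algebraMap (RatFunc ℝ) CircleRing) * !![cx, -cy; cy, cx]) i j := by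
    have hny : dR (-cy) = -cx := by rw [map_neg, hy]
    intro i j
    fin_cases i <;> fin_cases j <;>
      simp [Matrix.mul_apply, Fin.sum_univ_two, hx, hy, hny] <;> ring1
  have hadj : Algebra.adjoin (RatFunc ℝ)
      ({z | ∃ i j, !![cx, -cy; cy, cx] i j = z} ∪
        {z | ∃ i j, !![cx, cy; -cy, cx] i j = z}) = ⊤ := by
    rw [← top_le_iff, ← adjoin_cx_cy]
    refine Algebra.adjoin_mono ?_
    rintro z (rfl | rfl)
    · exact .inl ⟨0, 0, rfl⟩
    · exact .inl ⟨1, 0, rfl⟩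
  exact ⟨hdom, hsimple, hfrac, ⟨hW, hW', hsol, hadj⟩,
    { extends_deriv := hext
      isDomain := hdom
      exists_fundamental := ⟨_, _, hW, hW', hsol, hadj⟩
      constants_fraction := hfrac
      simple := hsimple }⟩
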